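/- Let γ > 0. There exists a constant C > 0 depending only on γ such that for every ϑ ∈ ℝ, every σ > 0, and X a random variable with distribution N(ϑ, σ²): (i) | E(|X|^γ) − |ϑ|^γ | ≤ C ( σ^γ 1_{|ϑ|≤σ} + σ² |ϑ|^{γ−2} 1_{|ϑ|>σ} ), and (ii) Var(|X|^γ) ≤ C ( σ^{2γ} 1_{|ϑ|≤σ} + σ² |ϑ|^{2γ−2} 1_{|ϑ|>σ} ). -/

import Mathlib

open MeasureTheory ProbabilityTheory Real

/-- Second-order Taylor bound for `u ↦ |1 + u| ^ γ` at `0`, valid on the whole line. -/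
lemma exists_abs_one_add_rpow_sub_le {γ : ℝ} (hγ : 0 < γ) :
    ∃ K : ℝ, 0 < K ∧ ∀ u : ℝ, |(|1 + u| ^ γ - 1 - γ * u)| ≤ K * (u ^ 2 * (1 + |u|) ^ γ) := by
  have hder : HasDerivAt (fun v : ℝ => γ * (1 + v) ^ (γ - 1)) (γ * (γ - 1)) 0 := by
    have h := (((hasDerivAt_id (0 : ℝ)).const_add 1).rpow_const (p := γ - 1)
      (Or.inl (by norm_num))).const_mul γ
    simpa using h
  obtain ⟨M, hM⟩ := hder.isBigO_sub.bound
  obtain ⟨ε, hε, hball⟩ := Metric.eventually_nhds_iff.mp hM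
  obtain ⟨δ, hδ, hδε, hδ1⟩ : ∃ δ : ℝ, 0 < δ ∧ δ < ε ∧ δ < 1 :=
    ⟨min ε 1 / 2, by positivity, by linarith [min_le_left ε 1, lt_min hε one_pos],
      by linarith [min_le_right ε 1, lt_min hε one_pos]⟩
  have hlocal : ∀ u : ℝ, |u| ≤ δ → |(|1 + u| ^ γ - 1 - γ * u)| ≤ |M| * u ^ 2 := by
    intro u hu
    have hd : ∀ v ∈ Set.Icc (-|u|) |u|, HasDerivWithinAt (fun v : ℝ => (1 + v) ^ γ - γ * v)
        (γ * (1 + v) ^ (γ - 1) - γ) (Set.Icc (-|u|) |u|) v := by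
      intro v hv
      have h := (((hasDerivAt_id v).const_add 1).rpow_const (p := γ)
        (Or.inl (by simp only [id]; linarith [hv.1]))).sub ((hasDerivAt_id v).const_mul γ)
      simp only [id, one_mul, mul_one] at h
      exact h.hasDerivWithinAt
    have hb : ∀ v ∈ Set.Icc (-|u|) |u|, ‖γ * (1 + v) ^ (γ - 1) - γ‖ ≤ |M| * |u| := by
      intro v hv
      have hvu : |v| ≤ |u| := abs_le.mpr hv
      have h := hball (y := v) (by simpa using (hvu.trans hu).trans_lt hδε)
      simp only [add_zero, one_rpow, mul_one, sub_zero] at h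
      calc ‖γ * (1 + v) ^ (γ - 1) - γ‖ ≤ M * ‖v‖ := h
        _ ≤ |M| * |u| := mul_le_mul (le_abs_self M) hvu (norm_nonneg _) (abs_nonneg _)
    have h := (convex_Icc (-|u|) |u|).norm_image_sub_le_of_norm_hasDerivWithin_le hd hb
      (x := 0) (y := u) (by simp) (abs_le.mp le_rfl)
    simp only [add_zero, one_rpow, mul_zero, sub_zero, Real.norm_eq_abs] at h
    rw [abs_of_pos (by linarith [neg_abs_le u] : 0 < 1 + u)]
    calc |((1 + u) ^ γ - 1 - γ * u)| = |(1 + u) ^ γ - γ * u - 1| := by ring_nf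
      _ ≤ |M| * |u| * |u| := h
      _ = |M| * u ^ 2 := by rw [mul_assoc, abs_mul_abs_self, sq]
  refine ⟨|M| + (2 + γ) / δ ^ 2, by positivity, fun u => ?_⟩
  have hone : 1 ≤ (1 + |u|) ^ γ := one_le_rpow (by linarith [abs_nonneg u]) hγ.le
  rcases le_total |u| δ with hu | hu
  · calc |(|1 + u| ^ γ - 1 - γ * u)| ≤ |M| * u ^ 2 := hlocal u hu
      _ ≤ (|M| + (2 + γ) / δ ^ 2) * (u ^ 2 * (1 + |u|) ^ γ) := by
        apply mul_le_mul _ _ (sq_nonneg u) (by positivity)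
        · have : 0 ≤ (2 + γ) / δ ^ 2 := by positivity
          linarith
        · exact le_mul_of_one_le_right (sq_nonneg u) hone
  · have h1 : |1 + u| ^ γ ≤ (1 + |u|) ^ γ :=
      rpow_le_rpow (abs_nonneg _) (by simpa using abs_add_le 1 u) hγ.le
    have h0 : 0 ≤ |1 + u| ^ γ := by positivity
    have hud : 1 ≤ |u| / δ := (one_le_div hδ).mpr hu
    have hsq : u ^ 2 / δ ^ 2 = (|u| / δ) ^ 2 := by rw [div_pow, sq_abs]
    have h2 : 1 ≤ u ^ 2 / δ ^ 2 := by rw [hsq]; exact one_le_pow₀ hud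
    have h3 : |u| ≤ u ^ 2 / δ ^ 2 := by
      rw [hsq]
      have : |u| ≤ |u| / δ := le_div_self (abs_nonneg u) hδ hδ1.le
      nlinarith
    have h4 : |(|1 + u| ^ γ - 1 - γ * u)| ≤ (1 + |u|) ^ γ + 1 + γ * |u| := by
      have hu1 := mul_le_mul_of_nonneg_left (le_abs_self u) hγ.le
      have hu2 := mul_le_mul_of_nonneg_left (neg_abs_le u) hγ.le
      rw [abs_le]; constructor <;> linarith
    calc |(|1 + u| ^ γ - 1 - γ * u)| ≤ (1 + |u|) ^ γ + 1 + γ * |u| := h4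
      _ ≤ (2 + γ) * (u ^ 2 / δ ^ 2) * (1 + |u|) ^ γ := by
        set w := (1 + |u|) ^ γ
        set q := u ^ 2 / δ ^ 2
        have hqw : q ≤ q * w := le_mul_of_one_le_right (by linarith) hone
        have hwq : w ≤ q * w := le_mul_of_one_le_left (by linarith) h2
        have : γ * |u| ≤ γ * (q * w) := mul_le_mul_of_nonneg_left (h3.trans hqw) hγ.le
        nlinarith
      _ = (2 + γ) / δ ^ 2 * (u ^ 2 * (1 + |u|) ^ γ) := by ring
      _ ≤ (|M| + (2 + γ) / δ ^ 2) * (u ^ 2 * (1 + |u|) ^ γ) := by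
        apply mul_le_mul_of_nonneg_right _ (by positivity)
        linarith [abs_nonneg M]

/-- The bound on the bias and, with `2 * γ` in place of `γ`, on the variance. -/
noncomputable def momentRate (γ ϑ σ : ℝ) : ℝ :=
  (if |ϑ| ≤ σ then σ ^ γ else 0) + (if σ < |ϑ| then σ ^ 2 * |ϑ| ^ (γ - 2) else 0)

lemma momentRate_of_le {γ ϑ σ : ℝ} (h : |ϑ| ≤ σ) : momentRate γ ϑ σ = σ ^ γ := by
  simp [momentRate, h, h.not_gt]

lemma momentRate_of_lt {γ ϑ σ : ℝ} (h : σ < |ϑ|) :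
    momentRate γ ϑ σ = σ ^ 2 * |ϑ| ^ (γ - 2) := by
  simp [momentRate, h, h.not_ge]

lemma momentRate_nonneg {γ ϑ σ : ℝ} (hσ : 0 < σ) : 0 ≤ momentRate γ ϑ σ := by
  unfold momentRate
  split_ifs <;> positivity

lemma abs_rpow_mul_momentRate_le {γ ϑ σ : ℝ} (hγ : 0 < γ) (hσ : 0 < σ) :
    |ϑ| ^ γ * momentRate γ ϑ σ ≤ momentRate (2 * γ) ϑ σ := by
  rcases le_or_gt |ϑ| σ with h | h
  · rw [momentRate_of_le h, momentRate_of_le h, two_mul, rpow_add hσ]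
    gcongr
  · rw [momentRate_of_lt h, momentRate_of_lt h,
      show 2 * γ - 2 = γ + (γ - 2) by ring, rpow_add (hσ.trans h)]
    exact le_of_eq (by ring)

/-- Up to a linear term, `|ϑ + σ z| ^ γ - |ϑ| ^ γ` is bounded by the rate times a polynomial
weight in `z`, uniformly in `ϑ` and `σ`. -/
lemma exists_abs_add_mul_rpow_sub_le {γ : ℝ} (hγ : 0 < γ) :
    ∃ K : ℝ, 0 < K ∧ ∀ ϑ σ : ℝ, 0 < σ → ∃ c : ℝ, ∀ z : ℝ,
      |(|ϑ + σ * z| ^ γ - |ϑ| ^ γ - c * z)| ≤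
        K * momentRate γ ϑ σ * (1 + |z|) ^ (γ + 2) := by
  obtain ⟨K, hK, hbound⟩ := exists_abs_one_add_rpow_sub_le hγ
  refine ⟨K + 1, by positivity, fun ϑ σ hσ => ?_⟩
  rcases le_or_gt |ϑ| σ with h | h
  · refine ⟨0, fun z => ?_⟩
    have hz : 1 ≤ 1 + |z| := by linarith [abs_nonneg z]
    rw [momentRate_of_le h, zero_mul, sub_zero]
    have hA : |ϑ + σ * z| ^ γ ≤ σ ^ γ * (1 + |z|) ^ (γ + 2) :=
      calc |ϑ + σ * z| ^ γ ≤ (σ * (1 + |z|)) ^ γ := by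
            apply rpow_le_rpow (abs_nonneg _) _ hγ.le
            calc |ϑ + σ * z| ≤ |ϑ| + |σ * z| := abs_add_le _ _
              _ ≤ σ * (1 + |z|) := by rw [abs_mul, abs_of_pos hσ]; linarith
        _ = σ ^ γ * (1 + |z|) ^ γ := mul_rpow hσ.le (by positivity)
        _ ≤ σ ^ γ * (1 + |z|) ^ (γ + 2) := by
            gcongr
            linarith
    have hB : |ϑ| ^ γ ≤ σ ^ γ * (1 + |z|) ^ (γ + 2) :=
      calc |ϑ| ^ γ ≤ σ ^ γ := rpow_le_rpow (abs_nonneg _) h hγ.le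
        _ ≤ σ ^ γ * (1 + |z|) ^ (γ + 2) :=
          le_mul_of_one_le_right (by positivity) (one_le_rpow hz (by linarith))
    have hA0 : 0 ≤ |ϑ + σ * z| ^ γ := by positivity
    have hB0 : 0 ≤ |ϑ| ^ γ := by positivity
    have hK0 : 0 ≤ K * (σ ^ γ * (1 + |z|) ^ (γ + 2)) := by positivity
    rw [show (K + 1) * σ ^ γ * (1 + |z|) ^ (γ + 2) =
      K * (σ ^ γ * (1 + |z|) ^ (γ + 2)) + σ ^ γ * (1 + |z|) ^ (γ + 2) by ring, abs_le]
    constructor <;> linarith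
  · have hϑ : 0 < |ϑ| := hσ.trans h
    have hϑ0 : ϑ ≠ 0 := abs_pos.mp hϑ
    refine ⟨|ϑ| ^ γ * (γ * (σ / ϑ)), fun z => ?_⟩
    have hu : |σ / ϑ * z| ≤ |z| := by
      rw [abs_mul, abs_div, abs_of_pos hσ]
      exact mul_le_of_le_one_left (abs_nonneg z) ((div_le_one hϑ).mpr h.le)
    have hfac : |ϑ + σ * z| ^ γ = |ϑ| ^ γ * |1 + σ / ϑ * z| ^ γ := by
      rw [← mul_rpow (abs_nonneg _) (abs_nonneg _), ← abs_mul]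
      congr 2
      field_simp
    have hrate : momentRate γ ϑ σ = |ϑ| ^ γ * (σ / ϑ) ^ 2 := by
      rw [momentRate_of_lt h, rpow_sub hϑ, rpow_two, sq_abs]
      ring
    have hweight : z ^ 2 * (1 + |σ / ϑ * z|) ^ γ ≤ (1 + |z|) ^ (γ + 2) := by
      rw [rpow_add (by positivity), rpow_two, mul_comm, ← sq_abs z]
      gcongr
      linarith
    calc |(|ϑ + σ * z| ^ γ - |ϑ| ^ γ - |ϑ| ^ γ * (γ * (σ / ϑ)) * z)|
        = |ϑ| ^ γ * |(|1 + σ / ϑ * z| ^ γ - 1 - γ * (σ / ϑ * z))| := by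
          rw [hfac, ← abs_of_nonneg (by positivity : 0 ≤ |ϑ| ^ γ), ← abs_mul,
            abs_of_nonneg (by positivity : 0 ≤ |ϑ| ^ γ)]
          ring_nf
      _ ≤ |ϑ| ^ γ * (K * ((σ / ϑ * z) ^ 2 * (1 + |σ / ϑ * z|) ^ γ)) := by
          gcongr
          exact hbound _
      _ = K * momentRate γ ϑ σ * (z ^ 2 * (1 + |σ / ϑ * z|) ^ γ) := by rw [hrate]; ring
      _ ≤ (K + 1) * momentRate γ ϑ σ * (1 + |z|) ^ (γ + 2) := by
          have := momentRate_nonneg (γ := γ) (ϑ := ϑ) hσ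
          gcongr
          linarith

lemma integrable_one_add_abs_rpow_gaussianReal {p : ℝ} (hp : 0 ≤ p) (m : ℝ) (v : NNReal) :
    Integrable (fun z : ℝ => (1 + |z|) ^ p) (gaussianReal m v) := by
  have h : MemLp (fun z : ℝ => 1 + |z|) (ENNReal.ofReal p) (gaussianReal m v) :=
    (memLp_const (1 : ℝ)).add (memLp_id_gaussianReal' _ ENNReal.ofReal_ne_top).norm
  have := h.integrable_norm_rpow'
  rw [ENNReal.toReal_ofReal hp] at this
  refine this.congr (Filter.Eventually.of_forall fun z => ?_)
  simp only [Real.norm_eq_abs]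
  rw [abs_of_nonneg (by positivity)]

lemma integrable_abs_rpow_gaussianReal {p : ℝ} (hp : 0 ≤ p) (m : ℝ) (v : NNReal) :
    Integrable (fun x : ℝ => |x| ^ p) (gaussianReal m v) := by
  have := (memLp_id_gaussianReal' (μ := m) (v := v) (ENNReal.ofReal p)
    ENNReal.ofReal_ne_top).integrable_norm_rpow'
  rwa [ENNReal.toReal_ofReal hp] at this

lemma gaussianReal_eq_map_standard (ϑ σ : ℝ) :
    gaussianReal ϑ (σ ^ 2).toNNReal = (gaussianReal 0 1).map (fun z => ϑ + σ * z) := by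
  have h : (fun z : ℝ => ϑ + σ * z) = (fun x => ϑ + x) ∘ (fun z => σ * z) := rfl
  rw [h, ← Measure.map_map (by fun_prop) (by fun_prop), gaussianReal_map_const_mul,
    gaussianReal_map_const_add]
  congr 1
  · simp
  · rw [mul_one]
    ext
    simp [sq_nonneg]

lemma exists_abs_integral_abs_rpow_gaussianReal_sub_le {γ : ℝ} (hγ : 0 < γ) :
    ∃ C : ℝ, 0 < C ∧ ∀ ϑ σ : ℝ, 0 < σ →
      |(∫ x, |x| ^ γ ∂(gaussianReal ϑ (σ ^ 2).toNNReal)) - |ϑ| ^ γ| ≤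
        C * momentRate γ ϑ σ := by
  obtain ⟨K, hK, hbound⟩ := exists_abs_add_mul_rpow_sub_le hγ
  set W : ℝ := ∫ z, (1 + |z|) ^ (γ + 2) ∂(gaussianReal 0 1)
  have hW0 : 0 ≤ W := integral_nonneg fun z => by positivity
  refine ⟨K * (W + 1), by positivity, fun ϑ σ hσ => ?_⟩
  obtain ⟨c, hc⟩ := hbound ϑ σ hσ
  have hpow : Integrable (fun z : ℝ => |ϑ + σ * z| ^ γ) (gaussianReal 0 1) := by
    have h := integrable_abs_rpow_gaussianReal hγ.le ϑ (σ ^ 2).toNNReal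
    rw [gaussianReal_eq_map_standard] at h
    exact h.comp_measurable (by fun_prop)
  have hid : Integrable (fun z : ℝ => z) (gaussianReal 0 1) :=
    memLp_one_iff_integrable.mp (memLp_id_gaussianReal 1)
  have hsub : Integrable (fun z : ℝ => |ϑ + σ * z| ^ γ - |ϑ| ^ γ) (gaussianReal 0 1) :=
    hpow.sub (integrable_const _)
  have hcalc : (∫ x, |x| ^ γ ∂(gaussianReal ϑ (σ ^ 2).toNNReal)) - |ϑ| ^ γ =
      ∫ z, (|ϑ + σ * z| ^ γ - |ϑ| ^ γ - c * z) ∂(gaussianReal 0 1) := by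
    rw [integral_sub hsub (hid.const_mul c),
      integral_sub hpow (integrable_const _), integral_const_mul, integral_id_gaussianReal,
      gaussianReal_eq_map_standard, integral_map (by fun_prop)
        (Measurable.aestronglyMeasurable (by fun_prop))]
    simp
  have hR := momentRate_nonneg (γ := γ) (ϑ := ϑ) hσ
  calc |(∫ x, |x| ^ γ ∂(gaussianReal ϑ (σ ^ 2).toNNReal)) - |ϑ| ^ γ|
      ≤ ∫ z, K * momentRate γ ϑ σ * (1 + |z|) ^ (γ + 2) ∂(gaussianReal 0 1) := by
        rw [hcalc, ← Real.norm_eq_abs]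
        exact norm_integral_le_of_norm_le
          ((integrable_one_add_abs_rpow_gaussianReal (p := γ + 2) (by linarith) 0 1).const_mul
            (K * momentRate γ ϑ σ))
          (Filter.Eventually.of_forall hc)
    _ = K * momentRate γ ϑ σ * W := integral_const_mul _ _
    _ ≤ K * (W + 1) * momentRate γ ϑ σ := by
        have : 0 ≤ K * momentRate γ ϑ σ := by positivity
        nlinarith

lemma variance_abs_rpow_gaussianReal {γ : ℝ} (hγ : 0 < γ) (m : ℝ) (v : NNReal) :
    variance (fun x => |x| ^ γ) (gaussianReal m v) =
      (∫ x, |x| ^ (2 * γ) ∂(gaussianReal m v)) - (∫ x, |x| ^ γ ∂(gaussianReal m v)) ^ 2 := by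
  have hsq : ∀ x : ℝ, (|x| ^ γ) ^ 2 = |x| ^ (2 * γ) := fun x => by
    rw [mul_comm, rpow_mul (abs_nonneg x), rpow_two]
  have hL : MemLp (fun x : ℝ => |x| ^ γ) 2 (gaussianReal m v) := by
    refine (memLp_two_iff_integrable_sq (Measurable.aestronglyMeasurable (by fun_prop))).mpr ?_
    simpa only [hsq] using integrable_abs_rpow_gaussianReal (by positivity) m v
  rw [variance_eq_sub hL]
  simp only [Pi.pow_apply, hsq]

/-- Lemma 1 (moments of `|X|^γ` for Gaussian `X`). For every `γ > 0` there is a constant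
`C > 0` depending only on `γ` such that for every `ϑ ∈ ℝ`, `σ > 0` and
`X ~ N(ϑ, σ²)`:
(i) `|E(|X|^γ) − |ϑ|^γ| ≤ C (σ^γ 1_{|ϑ|≤σ} + σ² |ϑ|^{γ-2} 1_{|ϑ|>σ})`, and
(ii) `Var(|X|^γ) ≤ C (σ^{2γ} 1_{|ϑ|≤σ} + σ² |ϑ|^{2γ-2} 1_{|ϑ|>σ})`. -/
theorem gaussian_abs_rpow_moments (γ : ℝ) (hγ : 0 < γ) :
    ∃ C : ℝ, 0 < C ∧
      ∀ ϑ σ : ℝ, 0 < σ →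
        (|(∫ x, |x| ^ γ ∂(gaussianReal ϑ (σ ^ 2).toNNReal)) - |ϑ| ^ γ| ≤
            C * ((if |ϑ| ≤ σ then σ ^ γ else 0) +
              (if σ < |ϑ| then σ ^ 2 * |ϑ| ^ (γ - 2) else 0))) ∧
          (variance (fun x => |x| ^ γ) (gaussianReal ϑ (σ ^ 2).toNNReal) ≤
            C * ((if |ϑ| ≤ σ then σ ^ (2 * γ) else 0) +
              (if σ < |ϑ| then σ ^ 2 * |ϑ| ^ (2 * γ - 2) else 0))) := by
  obtain ⟨C₁, hC₁, h₁⟩ := exists_abs_integral_abs_rpow_gaussianReal_sub_le hγ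
  obtain ⟨C₂, hC₂, h₂⟩ :=
    exists_abs_integral_abs_rpow_gaussianReal_sub_le (γ := 2 * γ) (by positivity)
  refine ⟨2 * C₁ + C₂, by positivity, fun ϑ σ hσ => ?_⟩
  change _ ≤ _ * momentRate γ ϑ σ ∧ _ ≤ _ * momentRate (2 * γ) ϑ σ
  have hR := momentRate_nonneg (γ := γ) (ϑ := ϑ) hσ
  constructor
  · exact (h₁ ϑ σ hσ).trans (by gcongr; linarith)
  · rw [variance_abs_rpow_gaussianReal hγ]
    have hA := (abs_le.mp (h₁ ϑ σ hσ)).1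
    have hB := (abs_le.mp (h₂ ϑ σ hσ)).2
    have hsq : |ϑ| ^ (2 * γ) = (|ϑ| ^ γ) ^ 2 := by
      rw [mul_comm, rpow_mul (abs_nonneg ϑ), rpow_two]
    rw [hsq] at hB
    have hmul := mul_le_mul_of_nonneg_left (abs_rpow_mul_momentRate_le (ϑ := ϑ) hγ hσ) hC₁.le
    have hp : 0 ≤ |ϑ| ^ γ := by positivity
    set A := ∫ x, |x| ^ γ ∂(gaussianReal ϑ (σ ^ 2).toNNReal)
    have hpA := mul_le_mul_of_nonneg_left hA hp
    nlinarith [sq_nonneg (A - |ϑ| ^ γ)]
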